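/- arXiv:2106.00827 — 3 statements merged into one kernel-verified Lean document; each statement's English description precedes it below -/
import Mathlib

section
/- Let X = {x₁, …, xₘ} be a finite set of distinct points in ℝⁿ. For every t > 0 the similarity matrix ζ_{tX} with entries exp(−t‖xᵢ − xⱼ‖) is invertible, and the magnitude function t ↦ Mag(tX) = 𝟙ᵀ ζ_{tX}⁻¹ 𝟙 is real-analytic on the open interval (0, ∞). -/
open Matrix

section SchurExponential

variable {ι : Type*} [Fintype ι]

lemma star_dotProduct_mulVec_eq_sum (A : Matrix ι ι ℝ) (c : ι → ℝ) :
    star c ⬝ᵥ A *ᵥ c = ∑ i, ∑ j, c i * c j * A i j := by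
  simp only [dotProduct, mulVec, Finset.mul_sum, star_trivial]
  exact Finset.sum_congr rfl fun i _ => Finset.sum_congr rfl fun j _ => by ring

lemma Matrix.PosSemidef.sum_nonneg {A : Matrix ι ι ℝ} (hA : A.PosSemidef) (c : ι → ℝ) :
    0 ≤ ∑ i, ∑ j, c i * c j * A i j := by
  rw [← star_dotProduct_mulVec_eq_sum]
  exact hA.dotProduct_mulVec_nonneg c

/-- Entrywise powers of a positive semidefinite matrix are positive semidefinite. -/
lemma Matrix.PosSemidef.map_pow {A : Matrix ι ι ℝ} (hA : A.PosSemidef) (k : ℕ) :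
    (A.map (· ^ k)).PosSemidef := by
  induction k with
  | zero =>
    convert posSemidef_vecMulVec_self_star (fun _ : ι => (1 : ℝ)) using 1
    ext i j
    simp [vecMulVec_apply]
  | succ k ih =>
    have h : A.map (· ^ (k + 1)) = A.map (· ^ k) ⊙ A := by
      ext i j
      simp [pow_succ]
    rw [h]
    exact ih.hadamard hA

lemma hasSum_pow_div_factorial_exp (y : ℝ) :
    HasSum (fun k : ℕ => y ^ k / (k.factorial : ℝ)) (Real.exp y) := by
  rw [Real.exp_eq_exp_ℝ]
  exact NormedSpace.expSeries_div_hasSum_exp y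

lemma hasSum_sum_mul_exp (A : Matrix ι ι ℝ) (c : ι → ℝ) (s : ℝ) :
    HasSum (fun k : ℕ => (s ^ k / (k.factorial : ℝ)) * ∑ i, ∑ j, c i * c j * A i j ^ k)
      (∑ i, ∑ j, c i * c j * Real.exp (s * A i j)) := by
  simp only [Finset.mul_sum]
  refine hasSum_sum fun i _ => hasSum_sum fun j _ => ?_
  refine ((hasSum_pow_div_factorial_exp (s * A i j)).mul_left (c i * c j)).congr_fun fun k => ?_
  rw [mul_pow]
  ring

lemma Matrix.PosSemidef.sum_exp_sub_one_nonneg {A : Matrix ι ι ℝ} (hA : A.PosSemidef)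
    (c : ι → ℝ) : 0 ≤ ∑ i, ∑ j, c i * c j * (Real.exp (A i j) - 1) := by
  have h := hasSum_sum_mul_exp A c 1
  have h0 := le_hasSum h 0 fun k _ => mul_nonneg (by positivity) ((hA.map_pow k).sum_nonneg c)
  simp only [mul_sub, Finset.sum_sub_distrib]
  simpa using h0

/-- The entrywise exponential of the Gram matrix of distinct vectors is definite. -/
lemma Matrix.PosSemidef.eq_zero_of_sum_exp_eq_zero {A : Matrix ι ι ℝ} (hA : A.PosSemidef)
    (hsep : ∀ i j, i ≠ j → 2 * A i j < A i i + A j j) (c : ι → ℝ)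
    (hc : ∑ i, ∑ j, c i * c j * Real.exp (A i j) = 0) : c = 0 := by
  have h := hasSum_sum_mul_exp A c 1
  simp only [one_mul, hc] at h
  have hpow (k : ℕ) : A.map (· ^ k) *ᵥ c = 0 := by
    have hk := congrFun ((hasSum_zero_iff_of_nonneg fun k =>
      mul_nonneg (by positivity) ((hA.map_pow k).sum_nonneg c)).1 h) k
    rw [← (hA.map_pow k).dotProduct_mulVec_zero_iff, star_dotProduct_mulVec_eq_sum]
    simpa [Nat.factorial_ne_zero] using hk
  have hexp (i : ι) (s : ℝ) : ∑ j, c j * Real.exp (s * A i j) = 0 := by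
    have hs : HasSum (fun k : ℕ => (s ^ k / (k.factorial : ℝ)) * (A.map (· ^ k) *ᵥ c) i)
        (∑ j, c j * Real.exp (s * A i j)) := by
      simp only [mulVec, dotProduct, Finset.mul_sum, map_apply]
      refine hasSum_sum fun j _ => ?_
      refine ((hasSum_pow_div_factorial_exp (s * A i j)).mul_left (c j)).congr_fun fun k => ?_
      rw [mul_pow]
      ring
    simp only [hpow, Pi.zero_apply, mul_zero] at hs
    exact hs.unique hasSum_zero
  classical
  by_contra hne
  have hsupp : (Finset.univ.filter fun i => c i ≠ 0).Nonempty := by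
    obtain ⟨i, hi⟩ := Function.ne_iff.1 hne
    exact ⟨i, by simpa using hi⟩
  obtain ⟨i, hi, hmax⟩ := Finset.exists_max_image _ (fun i => A i i) hsupp
  have hlim : Filter.Tendsto (fun s : ℝ => ∑ j, c j * Real.exp (s * (A i j - A i i)))
      Filter.atTop (nhds (∑ j, if j = i then c i else 0)) := by
    refine tendsto_finsetSum _ fun j _ => ?_
    by_cases hji : j = i
    · subst hji
      simp
    by_cases hcj : c j = 0
    · simp [hcj, hji]
    have hlt : A i j - A i i < 0 := by
      have h1 := hsep i j (Ne.symm hji)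
      have h2 := hmax j (by simpa using hcj)
      linarith
    rw [if_neg hji, ← mul_zero (c j)]
    exact (Real.tendsto_exp_atBot.comp
      (Filter.tendsto_id.atTop_mul_const_of_neg hlt)).const_mul (c j)
  have hzero (s : ℝ) : ∑ j, c j * Real.exp (s * (A i j - A i i)) = 0 := by
    have : ∑ j, c j * Real.exp (s * (A i j - A i i)) =
        Real.exp (-(s * A i i)) * ∑ j, c j * Real.exp (s * A i j) := by
      rw [Finset.mul_sum]
      refine Finset.sum_congr rfl fun j _ => ?_
      rw [mul_left_comm, ← Real.exp_add]
      ring_nf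
    rw [this, hexp, mul_zero]
  simp only [hzero, Finset.sum_ite_eq', Finset.mem_univ, if_true] at hlim
  have := tendsto_nhds_unique hlim tendsto_const_nhds
  simp [this] at hi

end SchurExponential

section DistanceKernel

open MeasureTheory

lemma integrable_one_sub_exp_neg_sq_div_sq (r : ℝ) :
    Integrable fun u : ℝ => (1 - Real.exp (-(u ^ 2 * r ^ 2))) / u ^ 2 := by
  refine (integrable_inv_one_add_sq.const_mul (1 + r ^ 2)).mono'
    (by fun_prop : Measurable _).aestronglyMeasurable (Filter.Eventually.of_forall fun u => ?_)
  rcases eq_or_ne u 0 with rfl | hu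
  · simp
    positivity
  have hu2 : 0 < u ^ 2 := by positivity
  have h1 : Real.exp (-(u ^ 2 * r ^ 2)) ≤ 1 := Real.exp_le_one_iff.2 (by
    have : 0 ≤ u ^ 2 * r ^ 2 := by positivity
    linarith)
  have h2 := Real.add_one_le_exp (-(u ^ 2 * r ^ 2))
  have h3 := Real.exp_pos (-(u ^ 2 * r ^ 2))
  rw [Real.norm_of_nonneg (div_nonneg (by linarith) hu2.le), ← div_eq_mul_inv,
    div_le_div_iff₀ hu2 (by positivity)]
  nlinarith

lemma integral_one_sub_exp_neg_sq_div_sq {r : ℝ} (hr : 0 ≤ r) :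
    ∫ u : ℝ, (1 - Real.exp (-(u ^ 2 * r ^ 2))) / u ^ 2 =
      r * ∫ u : ℝ, (1 - Real.exp (-u ^ 2)) / u ^ 2 := by
  rcases hr.eq_or_lt with rfl | hr
  · simp
  have h := Measure.integral_comp_mul_left (fun u : ℝ => (1 - Real.exp (-u ^ 2)) / u ^ 2) r
  rw [abs_of_pos (inv_pos.2 hr), smul_eq_mul] at h
  have h2 : ∀ u : ℝ, (1 - Real.exp (-(u ^ 2 * r ^ 2))) / u ^ 2 =
      r ^ 2 * ((1 - Real.exp (-(r * u) ^ 2)) / (r * u) ^ 2) := fun u => by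
    rw [mul_pow, mul_comm (r ^ 2) (u ^ 2)]
    rcases eq_or_ne u 0 with rfl | hu
    · simp
    field_simp
  simp only [h2]
  rw [integral_const_mul, h]
  field_simp

lemma integral_one_sub_exp_neg_sq_div_sq_pos :
    0 < ∫ u : ℝ, (1 - Real.exp (-u ^ 2)) / u ^ 2 := by
  have hint : Integrable fun u : ℝ => (1 - Real.exp (-u ^ 2)) / u ^ 2 := by
    simpa using integrable_one_sub_exp_neg_sq_div_sq 1
  have hnn : ∀ u : ℝ, 0 ≤ (1 - Real.exp (-u ^ 2)) / u ^ 2 := fun u =>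
    div_nonneg (sub_nonneg.2 (Real.exp_le_one_iff.2 (by nlinarith [sq_nonneg u]))) (sq_nonneg u)
  rw [integral_pos_iff_support_of_nonneg hnn hint]
  refine lt_of_lt_of_le (b := volume (Set.Ioo (0 : ℝ) 1)) (by simp) (measure_mono fun u hu => ?_)
  have hu2 : 0 < u ^ 2 := pow_pos hu.1 2
  have : Real.exp (-u ^ 2) < 1 := by
    rw [← Real.exp_zero]
    exact Real.exp_lt_exp.2 (by linarith)
  exact (div_pos (by linarith) hu2).ne'

variable {ι E : Type*} [Fintype ι] [NormedAddCommGroup E] [InnerProductSpace ℝ E]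

lemma sum_gaussian_increment_nonneg (x : ι → E) (c : ι → ℝ) (u : ℝ) :
    0 ≤ ∑ i, ∑ j, c i * c j *
      ((1 - Real.exp (-(u ^ 2 * ‖x i‖ ^ 2))) + (1 - Real.exp (-(u ^ 2 * ‖x j‖ ^ 2)))
        - (1 - Real.exp (-(u ^ 2 * dist (x i) (x j) ^ 2)))) := by
  have hpsd : ((2 * u ^ 2) • gram ℝ x).PosSemidef := (posSemidef_gram ℝ x).smul (by positivity)
  have h1 := hpsd.sum_exp_sub_one_nonneg fun i => c i * Real.exp (-(u ^ 2 * ‖x i‖ ^ 2))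
  have h2 := mul_self_nonneg (∑ i, c i * (1 - Real.exp (-(u ^ 2 * ‖x i‖ ^ 2))))
  rw [Finset.sum_mul_sum] at h2
  refine (add_nonneg h1 h2).trans_eq ?_
  simp only [← Finset.sum_add_distrib]
  refine Finset.sum_congr rfl fun i _ => Finset.sum_congr rfl fun j _ => ?_
  have hd : Real.exp (-(u ^ 2 * dist (x i) (x j) ^ 2)) = Real.exp (-(u ^ 2 * ‖x i‖ ^ 2)) *
      Real.exp (-(u ^ 2 * ‖x j‖ ^ 2)) * Real.exp (((2 * u ^ 2) • gram ℝ x) i j) := by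
    rw [← Real.exp_add, ← Real.exp_add, dist_eq_norm, norm_sub_sq_real, Matrix.smul_apply, gram_apply,
      smul_eq_mul]
    ring_nf
  rw [hd]
  ring

/-- The covariance kernel `‖x‖ + ‖y‖ - ‖x - y‖` is positive semidefinite. -/
lemma posSemidef_norm_add_norm_sub_dist (x : ι → E) :
    (Matrix.of fun i j => ‖x i‖ + ‖x j‖ - dist (x i) (x j)).PosSemidef := by
  refine .of_dotProduct_mulVec_nonneg ?_ fun c => ?_
  · ext i j
    simp [dist_comm, add_comm]
  rw [star_dotProduct_mulVec_eq_sum]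
  refine nonneg_of_mul_nonneg_left ?_ integral_one_sub_exp_neg_sq_div_sq_pos
  have hint := integrable_one_sub_exp_neg_sq_div_sq
  have hval (r : ℝ) (hr : 0 ≤ r) := integral_one_sub_exp_neg_sq_div_sq hr
  have hij (i j : ι) : Integrable fun u : ℝ => c i * c j *
      ((1 - Real.exp (-(u ^ 2 * ‖x i‖ ^ 2))) / u ^ 2 + (1 - Real.exp (-(u ^ 2 * ‖x j‖ ^ 2))) / u ^ 2
        - (1 - Real.exp (-(u ^ 2 * dist (x i) (x j) ^ 2))) / u ^ 2) :=
    (((hint _).add (hint _)).sub (hint _)).const_mul _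
  have hsum : (∑ i, ∑ j, c i * c j *
      (Matrix.of fun i j => ‖x i‖ + ‖x j‖ - dist (x i) (x j)) i j) *
        ∫ u : ℝ, (1 - Real.exp (-u ^ 2)) / u ^ 2 =
      ∫ u : ℝ, ∑ i, ∑ j, c i * c j *
      ((1 - Real.exp (-(u ^ 2 * ‖x i‖ ^ 2))) / u ^ 2 + (1 - Real.exp (-(u ^ 2 * ‖x j‖ ^ 2))) / u ^ 2
        - (1 - Real.exp (-(u ^ 2 * dist (x i) (x j) ^ 2))) / u ^ 2) := by
    rw [integral_finsetSum _ fun i _ => integrable_finsetSum _ fun j _ => hij i j, Finset.sum_mul]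
    refine Finset.sum_congr rfl fun i _ => ?_
    rw [integral_finsetSum _ fun j _ => hij i j, Finset.sum_mul]
    refine Finset.sum_congr rfl fun j _ => ?_
    have hadd := (hint ‖x i‖).add (hint ‖x j‖)
    simp only [Pi.add_def] at hadd
    rw [integral_const_mul, integral_sub hadd (hint _), integral_add (hint _) (hint _),
      hval _ (norm_nonneg _), hval _ (norm_nonneg _),
      hval _ dist_nonneg, of_apply]
    ring
  rw [hsum]
  refine integral_nonneg fun u => ?_
  refine (div_nonneg (sum_gaussian_increment_nonneg x c u) (sq_nonneg u)).trans_eq ?_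
  simp only [Finset.sum_div]
  exact Finset.sum_congr rfl fun i _ => Finset.sum_congr rfl fun j _ => by ring

/-- The Laplace kernel `exp (-t ‖x - y‖)` is nondegenerate on distinct points. -/
lemma det_exp_neg_mul_dist_ne_zero [DecidableEq ι] {x : ι → E} (hx : Function.Injective x)
    {t : ℝ} (ht : 0 < t) :
    (Matrix.of fun i j => Real.exp (-(t * dist (x i) (x j)))).det ≠ 0 := by
  intro hdet
  obtain ⟨v, hv, hv0⟩ := exists_mulVec_eq_zero_iff.2 hdet
  have hpsd := (posSemidef_norm_add_norm_sub_dist x).smul ht.le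
  have hc := hpsd.eq_zero_of_sum_exp_eq_zero (fun i j hij => ?_)
    (fun i => v i * Real.exp (-(t * ‖x i‖))) ?_
  · refine hv (funext fun i => ?_)
    simpa [Real.exp_ne_zero] using congrFun hc i
  · have : 0 < t * dist (x i) (x j) := mul_pos ht (dist_pos.2 (hx.ne hij))
    simp only [Matrix.smul_apply, of_apply, smul_eq_mul, dist_self]
    linarith
  · have h := star_dotProduct_mulVec_eq_sum
      (Matrix.of fun i j => Real.exp (-(t * dist (x i) (x j)))) v
    rw [hv0, dotProduct_zero] at h
    refine Eq.trans ?_ h.symm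
    refine Finset.sum_congr rfl fun i _ => Finset.sum_congr rfl fun j _ => ?_
    simp only [Matrix.smul_apply, of_apply, smul_eq_mul]
    rw [mul_mul_mul_comm, mul_assoc, ← Real.exp_add, ← Real.exp_add]
    ring_nf

end DistanceKernel

section Analytic

variable {ι 𝕜 E : Type*} [Fintype ι] [DecidableEq ι] [NontriviallyNormedField 𝕜]
  [NormedAddCommGroup E] [NormedSpace 𝕜 E]

lemma AnalyticAt.matrix_det {A : E → Matrix ι ι 𝕜} {t : E}
    (hA : ∀ i j, AnalyticAt 𝕜 (fun s => A s i j) t) :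
    AnalyticAt 𝕜 (fun s => (A s).det) t := by
  simp only [det_apply']
  exact Finset.analyticAt_fun_sum _ fun σ _ =>
    analyticAt_const.mul (Finset.analyticAt_fun_prod _ fun i _ => hA _ _)

lemma AnalyticAt.matrix_inv_apply {A : E → Matrix ι ι 𝕜} {t : E}
    (hA : ∀ i j, AnalyticAt 𝕜 (fun s => A s i j) t) (hdet : (A t).det ≠ 0) (i j : ι) :
    AnalyticAt 𝕜 (fun s => (A s)⁻¹ i j) t := by
  simp only [inv_def, Ring.inverse_eq_inv', Matrix.smul_apply, smul_eq_mul, adjugate_apply]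
  refine ((AnalyticAt.matrix_det hA).inv hdet).mul (AnalyticAt.matrix_det fun k l => ?_)
  by_cases hk : k = j
  · subst hk
    simp only [updateRow_self]
    exact analyticAt_const
  · simpa only [updateRow_ne hk] using hA k l

end Analytic

/-- For a finite set of distinct points in ℝⁿ, for every t > 0 the
similarity matrix ζ_{tX}(i,j) = exp(−t‖xᵢ − xⱼ‖) is invertible, and the magnitude
function t ↦ 𝟙ᵀ ζ_{tX}⁻¹ 𝟙 is real-analytic on (0, ∞). -/
theorem magnitude_function_analytic {n m : ℕ} (x : Fin m → EuclideanSpace ℝ (Fin n))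
    (hx : Function.Injective x) :
    (∀ t : ℝ, 0 < t →
      IsUnit (Matrix.of fun i j : Fin m => Real.exp (-(t * dist (x i) (x j)))).det) ∧
    AnalyticOnNhd ℝ
      (fun t : ℝ =>
        dotProduct (fun _ : Fin m => (1 : ℝ))
          ((Matrix.of fun i j : Fin m => Real.exp (-(t * dist (x i) (x j))))⁻¹ *ᵥ
            fun _ : Fin m => (1 : ℝ)))
      (Set.Ioi 0) := by
  have hdet (t : ℝ) (ht : 0 < t) := det_exp_neg_mul_dist_ne_zero hx ht
  refine ⟨fun t ht => isUnit_iff_ne_zero.2 (hdet t ht), fun t ht => ?_⟩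
  simp only [dotProduct, mulVec, one_mul, mul_one]
  refine Finset.analyticAt_fun_sum _ fun i _ => Finset.analyticAt_fun_sum _ fun j _ => ?_
  refine AnalyticAt.matrix_inv_apply
    (A := fun s : ℝ => Matrix.of fun i j => Real.exp (-(s * dist (x i) (x j))))
    (fun k l => ?_) (hdet t ht) i j
  simp only [of_apply]
  fun_prop
end

section
/- Let X be a finite metric space with n points that is scattered, i.e. e^{−ε} < 1/(n−1) where ε is the smallest distance between distinct points of X. Then for every a ∈ X, the weighting vector satisfies w_X(a) = 1 + Σ_{k=1}^{∞} (−1)^k Σ_{b∈X} μ_k(a,b), where the series converges and μ_k(a,b) is the (a,b) entry of (ζ_X − I)^k. -/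
open Matrix

open scoped Matrix.Norms.Operator in
/-- Neumann series for a matrix whose absolute row sums are all less than one. -/
theorem Matrix.hasSum_neg_pow_inv_one_add {n : Type*} [Fintype n] [DecidableEq n]
    (A : Matrix n n ℝ) (hA : ∀ i, ∑ j, |A i j| < 1) :
    HasSum (fun k : ℕ => (-A) ^ k) (1 + A)⁻¹ := by
  have hnorm : ‖-A‖ < 1 := by
    rw [norm_neg, linfty_opNorm_def, ← NNReal.coe_one, NNReal.coe_lt_coe,
      Finset.sup_lt_iff (by simp)]
    intro i _
    rw [← NNReal.coe_lt_coe]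
    simpa using hA i
  have hinv := mul_neg_geom_series (-A) hnorm
  rw [sub_neg_eq_add] at hinv
  rw [inv_eq_right_inv hinv]
  exact (summable_geometric_of_norm_lt_one hnorm).hasSum

theorem Matrix.hasSum_inv_mulVec_one {n : Type*} [Fintype n] [DecidableEq n]
    (A : Matrix n n ℝ) (hA : ∀ i, ∑ j, |A i j| < 1) (i : n) :
    HasSum (fun k : ℕ => (-1 : ℝ) ^ k * ∑ j, (A ^ k) i j)
      (((1 + A)⁻¹ *ᵥ fun _ => (1 : ℝ)) i) := by
  have h := hasSum_sum (s := Finset.univ) fun j _ =>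
    Pi.hasSum.1 (Pi.hasSum.1 (A.hasSum_neg_pow_inv_one_add hA) i) j
  convert h using 1
  · funext k
    rw [Finset.mul_sum]
    refine Finset.sum_congr rfl fun j _ => ?_
    rcases Nat.even_or_odd k with hk | hk <;> simp [hk.neg_pow]
  · simp [mulVec, dotProduct]

theorem sum_abs_similarity_sub_one_lt_one {X : Type*} [Fintype X] [DecidableEq X]
    [MetricSpace X] (ε : ℝ)
    (hε : IsLeast { d : ℝ | ∃ a b : X, a ≠ b ∧ d = dist a b } ε)
    (hscat : Real.exp (-ε) < 1 / ((Fintype.card X : ℝ) - 1)) (i : X) :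
    ∑ j, |((Matrix.of fun c d : X => Real.exp (-dist c d)) - 1) i j| < 1 := by
  obtain ⟨⟨x, y, hxy, -⟩, hmin⟩ := hε
  have hcard : (1 : ℝ) < Fintype.card X := by
    exact_mod_cast Fintype.one_lt_card_iff.2 ⟨x, y, hxy⟩
  rw [lt_div_iff₀ (by linarith)] at hscat
  calc ∑ j, |((Matrix.of fun c d : X => Real.exp (-dist c d)) - 1) i j|
      = ∑ j ∈ Finset.univ.erase i, Real.exp (-dist i j) := by
        rw [← Finset.add_sum_erase _ _ (Finset.mem_univ i)]
        simp only [Matrix.sub_apply, Matrix.of_apply, dist_self, neg_zero, Real.exp_zero,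
          Matrix.one_apply_eq, sub_self, abs_zero, zero_add]
        refine Finset.sum_congr rfl fun j hj => ?_
        rw [Matrix.one_apply_ne (Finset.ne_of_mem_erase hj).symm, sub_zero, Real.abs_exp]
    _ ≤ ∑ _j ∈ Finset.univ.erase i, Real.exp (-ε) := by
        refine Finset.sum_le_sum fun j hj => ?_
        have := hmin ⟨i, j, (Finset.ne_of_mem_erase hj).symm, rfl⟩
        gcongr
    _ = Real.exp (-ε) * ((Fintype.card X : ℝ) - 1) := by
        rw [Finset.sum_const, nsmul_eq_mul, Finset.cast_card_erase_of_mem (Finset.mem_univ i),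
          Finset.card_univ, mul_comm]
    _ < 1 := hscat

/-- Let X be a finite metric space with n points that is scattered, i.e.
e^{−ε} < 1/(n−1) where ε is the smallest distance between distinct points of X. Then
for every a ∈ X, the weighting vector w_X = ζ_X⁻¹𝟙 satisfies
w_X(a) = 1 + Σ_{k=1}^{∞} (−1)^k Σ_{b∈X} μ_k(a,b), the series converging, where
μ_k(a,b) is the (a,b) entry of (ζ_X − I)^k. -/
theorem scattered_weight_series {X : Type*} [Fintype X] [DecidableEq X] [MetricSpace X]
    (ε : ℝ) (hε : IsLeast { d : ℝ | ∃ a b : X, a ≠ b ∧ d = dist a b } ε)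
    (hscat : Real.exp (-ε) < 1 / ((Fintype.card X : ℝ) - 1))
    (a : X) :
    Summable (fun k : ℕ => (-1 : ℝ) ^ (k + 1) *
      ∑ b : X, (((Matrix.of fun c d : X => Real.exp (-dist c d)) - 1) ^ (k + 1)) a b) ∧
    ((Matrix.of fun c d : X => Real.exp (-dist c d))⁻¹ *ᵥ fun _ : X => (1 : ℝ)) a =
      1 + ∑' k : ℕ, (-1 : ℝ) ^ (k + 1) *
        ∑ b : X, (((Matrix.of fun c d : X => Real.exp (-dist c d)) - 1) ^ (k + 1)) a b := by
  have h := Matrix.hasSum_inv_mulVec_one _ (sum_abs_similarity_sub_one_lt_one ε hε hscat) a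
  rw [add_sub_cancel] at h
  refine ⟨(summable_nat_add_iff 1).2 h.summable, ?_⟩
  rw [← h.tsum_eq, h.summable.tsum_eq_zero_add]
  simp [Matrix.one_apply]
end

section
/- Let Y ⊆ X be finite sets of distinct points in ℝⁿ, with the points of X indexed so that those of Y come first, giving the block decomposition ζ_X = [[ζ_Y, ζ_{Y,Ȳ}], [ζ_{Y,Ȳ}ᵀ, ζ_Ȳ]] where Ȳ = X∖Y. Then the Schur complement ζ_X/ζ_Y = ζ_Ȳ − ζ_{Y,Ȳ}ᵀ ζ_Y⁻¹ ζ_{Y,Ȳ} is invertible, and with ρ_XY = [[ζ_Y⁻¹ζ_{Y,Ȳ}(ζ_X/ζ_Y)⁻¹ζ_{Y,Ȳ}ᵀζ_Y⁻¹, −ζ_Y⁻¹ζ_{Y,Ȳ}(ζ_X/ζ_Y)⁻¹], [−(ζ_X/ζ_Y)⁻¹ζ_{Y,Ȳ}ᵀζ_Y⁻¹, (ζ_X/ζ_Y)⁻¹]], one has w_X = [w_Y; 0] + ρ_XY·𝟙 and Mag(X) = Mag(Y) + 𝟙ᵀ ρ_XY 𝟙. -/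
open Matrix

open MeasureTheory Set Filter Topology in
theorem integrableOn_and_integral_exp_neg_sub_div_sq {a : ℝ} (ha : 0 < a) :
    IntegrableOn (fun v : ℝ => Real.exp (-(v - a / v) ^ 2)) (Ioi 0) ∧
      ∫ v in Ioi (0 : ℝ), Real.exp (-(v - a / v) ^ 2) = √Real.pi / 2 := by
  have hφ : ∀ v ∈ Ioi (0 : ℝ), HasDerivWithinAt (fun v => v - a / v) (1 + a / v ^ 2) (Ioi 0) v := by
    intro v hv
    have hv0 : v ≠ 0 := ne_of_gt hv
    have h := (hasDerivAt_id v).sub ((hasDerivAt_inv hv0).const_mul a)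
    refine (h.congr_deriv ?_).hasDerivWithinAt
    field_simp
    ring
  have hψ : ∀ v ∈ Ioi (0 : ℝ), HasDerivWithinAt (fun v => a / v) (-(a / v ^ 2)) (Ioi 0) v := by
    intro v hv
    have hv0 : v ≠ 0 := ne_of_gt hv
    refine (((hasDerivAt_inv hv0).const_mul a).congr_deriv ?_).hasDerivWithinAt
    field_simp
  have hφinj : InjOn (fun v : ℝ => v - a / v) (Ioi 0) := by
    apply StrictMonoOn.injOn
    intro u hu v _ huv
    have : a / v < a / u := div_lt_div_of_pos_left ha hu huv
    simp only
    linarith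
  have hψinj : InjOn (fun v : ℝ => a / v) (Ioi 0) := by
    intro u hu v hv huv
    have hu0 : u ≠ 0 := ne_of_gt hu
    have hv0 : v ≠ 0 := ne_of_gt hv
    simp only at huv
    field_simp at huv
    exact huv.symm
  have hφim : (fun v : ℝ => v - a / v) '' Ioi 0 = univ := by
    refine eq_univ_of_forall fun t => ?_
    have hs : √(t ^ 2 + 4 * a) ^ 2 = t ^ 2 + 4 * a := Real.sq_sqrt (by positivity)
    have hlt : |t| < √(t ^ 2 + 4 * a) := by
      rw [← Real.sqrt_sq_eq_abs]
      exact Real.sqrt_lt_sqrt (sq_nonneg t) (by linarith)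
    have hpos : 0 < (t + √(t ^ 2 + 4 * a)) / 2 := by linarith [neg_abs_le t]
    refine ⟨_, hpos, ?_⟩
    generalize √(t ^ 2 + 4 * a) = r at hs hpos
    have : t + r ≠ 0 := by intro h; simp [h] at hpos
    simp only
    field_simp
    linarith
  have hψim : (fun v : ℝ => a / v) '' Ioi 0 = Ioi 0 := by
    ext t
    refine ⟨?_, fun ht => ⟨a / t, div_pos ha ht, div_div_cancel₀ ha.ne'⟩⟩
    rintro ⟨v, hv, rfl⟩
    exact div_pos ha hv
  have hgauss : Integrable fun x : ℝ => Real.exp (-x ^ 2) := by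
    simpa using integrable_exp_neg_mul_sq one_pos
  have habs : ∀ v : ℝ, |1 + a / v ^ 2| = 1 + a / v ^ 2 := fun v => abs_of_nonneg (by positivity)
  have habs' : ∀ v : ℝ, |-(a / v ^ 2)| = a / v ^ 2 := fun v => by
    rw [abs_neg]; exact abs_of_nonneg (by positivity)
  have hint : IntegrableOn
      (fun v : ℝ => (1 + a / v ^ 2) * Real.exp (-(v - a / v) ^ 2)) (Ioi 0) := by
    have := (integrableOn_image_iff_integrableOn_abs_deriv_smul measurableSet_Ioi hφ hφinj
      fun x : ℝ => Real.exp (-x ^ 2)).1 (hφim ▸ hgauss.integrableOn)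
    simpa only [habs, smul_eq_mul] using this
  have heq : ∫ v in Ioi (0 : ℝ), (1 + a / v ^ 2) * Real.exp (-(v - a / v) ^ 2) = √Real.pi := by
    have := integral_image_eq_integral_abs_deriv_smul measurableSet_Ioi hφ hφinj
      fun x : ℝ => Real.exp (-x ^ 2)
    simp only [habs, smul_eq_mul, hφim, setIntegral_univ] at this
    rw [← this]
    simpa using integral_gaussian 1
  have hf : IntegrableOn (fun v : ℝ => Real.exp (-(v - a / v) ^ 2)) (Ioi 0) := by
    refine Integrable.mono' hint (Measurable.aestronglyMeasurable (by fun_prop))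
      (ae_of_all _ fun v => ?_)
    rw [Real.norm_of_nonneg (Real.exp_pos _).le]
    have : 0 ≤ a / v ^ 2 := by positivity
    exact le_mul_of_one_le_left (Real.exp_pos _).le (by linarith)
  have hsymm : ∫ v in Ioi (0 : ℝ), Real.exp (-(v - a / v) ^ 2) =
      ∫ v in Ioi (0 : ℝ), a / v ^ 2 * Real.exp (-(v - a / v) ^ 2) := by
    have := integral_image_eq_integral_abs_deriv_smul measurableSet_Ioi hψ hψinj
      fun v : ℝ => Real.exp (-(v - a / v) ^ 2)
    simp only [habs', smul_eq_mul, hψim] at this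
    rw [this]
    congr 1 with v
    rw [div_div_cancel₀ ha.ne', ← neg_sub, neg_sq]
  have hint' : IntegrableOn (fun v : ℝ => a / v ^ 2 * Real.exp (-(v - a / v) ^ 2)) (Ioi 0) :=
    (hint.sub hf).congr (ae_of_all _ fun v => by simp only [Pi.sub_apply]; ring)
  refine ⟨hf, ?_⟩
  simp only [add_mul, one_mul] at heq
  rw [integral_add hf hint', ← hsymm] at heq
  linarith

open MeasureTheory Set in
/-- The subordination formula expressing `exp (-r)` as a mixture of Gaussians in `r`. -/
theorem integrableOn_and_integral_exp_neg_sq_sub_sq_div {r : ℝ} (hr : 0 ≤ r) :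
    IntegrableOn (fun v : ℝ => Real.exp (-v ^ 2 - r ^ 2 / (4 * v ^ 2))) (Ioi 0) ∧
      ∫ v in Ioi (0 : ℝ), Real.exp (-v ^ 2 - r ^ 2 / (4 * v ^ 2)) =
        √Real.pi / 2 * Real.exp (-r) := by
  rcases hr.eq_or_lt with rfl | hr
  · have h₁ := (integrable_exp_neg_mul_sq one_pos).integrableOn (s := Ioi 0)
    have h₂ := integral_gaussian_Ioi 1
    simp only [neg_mul, one_mul, div_one] at h₁ h₂
    simpa using ⟨h₁, h₂⟩
  · obtain ⟨h₁, h₂⟩ := integrableOn_and_integral_exp_neg_sub_div_sq (half_pos hr)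
    have h : EqOn (fun v : ℝ => Real.exp (-v ^ 2 - r ^ 2 / (4 * v ^ 2)))
        (fun v => Real.exp (-(v - r / 2 / v) ^ 2) * Real.exp (-r)) (Ioi 0) := by
      intro v hv
      have hv0 : v ≠ 0 := ne_of_gt hv
      simp only
      rw [← Real.exp_add]
      congr 1
      field_simp
      ring
    refine ⟨IntegrableOn.congr_fun (h₁.mul_const _) h.symm measurableSet_Ioi, ?_⟩
    rw [setIntegral_congr_fun measurableSet_Ioi h, integral_mul_const, h₂]

section

variable {ι E : Type*} [Fintype ι] [NormedAddCommGroup E] [InnerProductSpace ℝ E]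
  [FiniteDimensional ℝ E]

open MeasureTheory in
theorem sum_sum_mul_exp_neg_mul_dist_sq_nonneg (x : ι → E) (c : ι → ℝ) {s : ℝ} (hs : 0 < s) :
    0 ≤ ∑ i, ∑ j, c i * c j * Real.exp (-s * dist (x i) (x j) ^ 2) := by
  borelize E
  have hcont : 0 < ∫ w : E, Real.exp (-(4 * s) * ‖w‖ ^ 2) := by
    rw [GaussianFourier.integral_rexp_neg_mul_sq_norm (by positivity)]
    positivity
  have hint : Integrable fun w : E => Real.exp (-(4 * s) * ‖w‖ ^ 2) :=
    not_imp_comm.1 integral_undef hcont.ne'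
  set C := ∫ w : E, Real.exp (-(4 * s) * ‖w‖ ^ 2)
  have hprod (a b : E) : (fun w : E => Real.exp (-(2 * s) * ‖w - a‖ ^ 2) *
      Real.exp (-(2 * s) * ‖w - b‖ ^ 2)) = fun w => Real.exp (-s * dist a b ^ 2) *
        Real.exp (-(4 * s) * ‖w - (1 / 2 : ℝ) • (a + b)‖ ^ 2) := by
    ext w
    rw [← Real.exp_add, ← Real.exp_add, dist_eq_norm]
    congr 1
    have h := parallelogram_law_with_norm ℝ (w - a) (w - b)
    have e₁ : w - a + (w - b) = (2 : ℝ) • (w - (1 / 2 : ℝ) • (a + b)) := by module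
    have e₂ : w - a - (w - b) = -(a - b) := by abel
    rw [e₁, e₂, norm_smul, norm_neg, Real.norm_two] at h
    linear_combination s * h
  have hint₂ (a b : E) : Integrable fun w : E => Real.exp (-(2 * s) * ‖w - a‖ ^ 2) *
      Real.exp (-(2 * s) * ‖w - b‖ ^ 2) := by
    rw [hprod]
    exact (hint.comp_sub_right _).const_mul _
  have hval (a b : E) : ∫ w : E, Real.exp (-(2 * s) * ‖w - a‖ ^ 2) *
      Real.exp (-(2 * s) * ‖w - b‖ ^ 2) = Real.exp (-s * dist a b ^ 2) * C := by
    rw [hprod, integral_const_mul,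
      integral_sub_right_eq_self fun w : E => Real.exp (-(4 * s) * ‖w‖ ^ 2)]
  have key : (∑ i, ∑ j, c i * c j * Real.exp (-s * dist (x i) (x j) ^ 2)) * C =
      ∫ w : E, (∑ i, c i * Real.exp (-(2 * s) * ‖w - x i‖ ^ 2)) ^ 2 := by
    have hsq (w : E) : (∑ i, c i * Real.exp (-(2 * s) * ‖w - x i‖ ^ 2)) ^ 2 =
        ∑ i, ∑ j, c i * c j * (Real.exp (-(2 * s) * ‖w - x i‖ ^ 2) *
          Real.exp (-(2 * s) * ‖w - x j‖ ^ 2)) := by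
      rw [sq, Finset.sum_mul_sum]
      exact Finset.sum_congr rfl fun i _ => Finset.sum_congr rfl fun j _ => by ring
    simp only [hsq]
    rw [integral_finsetSum _ fun i _ => integrable_finsetSum _ fun j _ =>
      (hint₂ (x i) (x j)).const_mul _, Finset.sum_mul]
    refine Finset.sum_congr rfl fun i _ => ?_
    rw [integral_finsetSum _ fun j _ => (hint₂ (x i) (x j)).const_mul _, Finset.sum_mul]
    refine Finset.sum_congr rfl fun j _ => ?_
    rw [integral_const_mul, hval, mul_assoc]
  refine nonneg_of_mul_nonneg_left ?_ hcont
  rw [key]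
  exact integral_nonneg fun w => sq_nonneg _

open Filter Topology in
theorem tendsto_exp_neg_sq_sub_sq_div (r : ℝ) :
    Tendsto (fun v : ℝ => Real.exp (-v ^ 2 - r ^ 2 / (4 * v ^ 2))) (𝓝[>] 0)
      (𝓝 (if r = 0 then 1 else 0)) := by
  have h₀ : Tendsto (fun v : ℝ => v) (𝓝[>] 0) (𝓝 0) := tendsto_nhdsWithin_of_tendsto_nhds tendsto_id
  have h₁ : Tendsto (fun v : ℝ => -v ^ 2) (𝓝[>] 0) (𝓝 0) := by simpa using (h₀.pow 2).neg
  split_ifs with hr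
  · subst hr
    simpa [Function.comp_def] using Real.continuous_exp.continuousAt.tendsto.comp h₁
  · have h₂ : Tendsto (fun v : ℝ => r ^ 2 / (4 * v ^ 2)) (𝓝[>] 0) atTop := by
      have := ((tendsto_pow_atTop two_ne_zero).comp
        (tendsto_inv_nhdsGT_zero (𝕜 := ℝ))).const_mul_atTop (show 0 < r ^ 2 / 4 by positivity)
      refine this.congr fun v => ?_
      simp only [Function.comp_apply]
      rw [inv_pow, div_mul_eq_div_div, div_eq_mul_inv _ (v ^ 2)]
    refine Real.tendsto_exp_atBot.comp ?_
    simpa only [sub_eq_add_neg, Function.comp_def] using h₁.add_atBot (tendsto_neg_atTop_atBot.comp h₂)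

open MeasureTheory Set Filter Topology in
theorem sum_sum_mul_exp_neg_dist_pos {x : ι → E} (hx : Function.Injective x) {c : ι → ℝ}
    (hc : c ≠ 0) : 0 < ∑ i, ∑ j, c i * c j * Real.exp (-dist (x i) (x j)) := by
  classical
  set Q : ℝ → ℝ := fun v => ∑ i, ∑ j, c i * c j *
    Real.exp (-v ^ 2 - dist (x i) (x j) ^ 2 / (4 * v ^ 2)) with hQ
  have hmix (i j : ι) := integrableOn_and_integral_exp_neg_sq_sub_sq_div
    (dist_nonneg (x := x i) (y := x j))
  have hQint : IntegrableOn Q (Ioi 0) := integrable_finsetSum _ fun i _ =>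
    integrable_finsetSum _ fun j _ => (hmix i j).1.const_mul _
  have hQval : ∫ v in Ioi (0 : ℝ), Q v =
      √Real.pi / 2 * ∑ i, ∑ j, c i * c j * Real.exp (-dist (x i) (x j)) := by
    rw [integral_finsetSum _ fun i _ => integrable_finsetSum _ fun j _ =>
      (hmix i j).1.const_mul _, Finset.mul_sum]
    refine Finset.sum_congr rfl fun i _ => ?_
    rw [integral_finsetSum _ fun j _ => (hmix i j).1.const_mul _, Finset.mul_sum]
    refine Finset.sum_congr rfl fun j _ => ?_
    rw [integral_const_mul, (hmix i j).2]
    ring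
  have hQnonneg : ∀ v ∈ Ioi (0 : ℝ), 0 ≤ Q v := by
    intro v hv
    have hv0 : 0 < v := hv
    have h := sum_sum_mul_exp_neg_mul_dist_sq_nonneg x c (s := 1 / (4 * v ^ 2)) (by positivity)
    have : Q v = Real.exp (-v ^ 2) *
        ∑ i, ∑ j, c i * c j * Real.exp (-(1 / (4 * v ^ 2)) * dist (x i) (x j) ^ 2) := by
      simp only [hQ, Finset.mul_sum]
      refine Finset.sum_congr rfl fun i _ => Finset.sum_congr rfl fun j _ => ?_
      rw [mul_left_comm, ← Real.exp_add]
      congr 2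
      ring
    rw [this]
    positivity
  have hQlim : Tendsto Q (𝓝[>] 0) (𝓝 (∑ i, c i * c i)) := by
    have : ∑ i, c i * c i =
        ∑ i, ∑ j, c i * c j * (if dist (x i) (x j) = 0 then 1 else 0) := by
      simp [hx.eq_iff]
    rw [this]
    exact tendsto_finsetSum _ fun i _ => tendsto_finsetSum _ fun j _ =>
      (tendsto_exp_neg_sq_sub_sq_div _).const_mul _
  have hsq : 0 < ∑ i, c i * c i := by
    obtain ⟨i, hi⟩ := Function.ne_iff.1 hc
    exact Finset.sum_pos' (fun i _ => mul_self_nonneg _)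
      ⟨i, Finset.mem_univ _, mul_self_pos.2 hi⟩
  obtain ⟨ε, hε, hpos⟩ := mem_nhdsGT_iff_exists_Ioo_subset.1 (hQlim.eventually_const_lt hsq)
  have hint : 0 < ∫ v in Ioi (0 : ℝ), Q v := by
    rw [setIntegral_pos_iff_support_of_nonneg_ae
      ((ae_restrict_iff' measurableSet_Ioi).2 (ae_of_all _ hQnonneg)) hQint]
    refine lt_of_lt_of_le ?_ (measure_mono (s := Ioo 0 ε) fun v hv =>
      ⟨(show 0 < Q v from hpos hv).ne', hv.1⟩)
    simpa using hε
  rw [hQval] at hint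
  exact pos_of_mul_pos_right hint (by positivity)

/-- The similarity matrix of finitely many distinct points of a Euclidean space is positive
definite. -/
theorem posDef_exp_neg_dist {x : ι → E} (hx : Function.Injective x) :
    (Matrix.of fun i j => Real.exp (-dist (x i) (x j))).PosDef := by
  refine Matrix.PosDef.of_dotProduct_mulVec_pos ?_ fun c hc => ?_
  · exact Matrix.IsHermitian.ext fun i j => by simp [dist_comm]
  · refine (sum_sum_mul_exp_neg_dist_pos hx hc).trans_eq ?_
    simp only [dotProduct, mulVec, Finset.mul_sum, star_trivial, Matrix.of_apply]
    exact Finset.sum_congr rfl fun i _ => Finset.sum_congr rfl fun j _ => by ring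

end

/-- Block inversion in terms of the Schur complement of the upper left block. -/
theorem inv_fromBlocks_eq_add {m n R : Type*} [Fintype m] [Fintype n] [DecidableEq m]
    [DecidableEq n] [CommRing R] (A : Matrix m m R) (B : Matrix m n R) (C : Matrix n m R)
    (D : Matrix n n R) (hA : IsUnit A.det) (hS : IsUnit (D - C * A⁻¹ * B).det) :
    (fromBlocks A B C D)⁻¹ = fromBlocks A⁻¹ 0 0 0 +
      fromBlocks (A⁻¹ * B * (D - C * A⁻¹ * B)⁻¹ * C * A⁻¹)
        (-(A⁻¹ * B * (D - C * A⁻¹ * B)⁻¹)) (-((D - C * A⁻¹ * B)⁻¹ * C * A⁻¹))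
        (D - C * A⁻¹ * B)⁻¹ := by
  have := A.invertibleOfIsUnitDet hA
  have := (D - C * A⁻¹ * B).invertibleOfIsUnitDet hS
  have : Invertible (D - C * ⅟A * B) := by rwa [invOf_eq_nonsing_inv]
  have := fromBlocks₁₁Invertible A B C D
  rw [← invOf_eq_nonsing_inv (fromBlocks A B C D), invOf_fromBlocks₁₁_eq, fromBlocks_add]
  simp only [invOf_eq_nonsing_inv, zero_add]

/-- Let Y ⊆ X be finite sets of distinct points in ℝⁿ, with the points of Y
(family `y`) coming first and those of Ȳ = X∖Y (family `z`) second, giving the block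
decomposition ζ_X = [[ζ_Y, ζ_{Y,Ȳ}], [ζ_{Y,Ȳ}ᵀ, ζ_Ȳ]]. Then the Schur complement
ζ_X/ζ_Y = ζ_Ȳ − ζ_{Y,Ȳ}ᵀ ζ_Y⁻¹ ζ_{Y,Ȳ} is invertible, and with
ρ_XY = [[ζ_Y⁻¹ζ_{Y,Ȳ}(ζ_X/ζ_Y)⁻¹ζ_{Y,Ȳ}ᵀζ_Y⁻¹, −ζ_Y⁻¹ζ_{Y,Ȳ}(ζ_X/ζ_Y)⁻¹],
        [−(ζ_X/ζ_Y)⁻¹ζ_{Y,Ȳ}ᵀζ_Y⁻¹, (ζ_X/ζ_Y)⁻¹]],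
one has w_X = [w_Y; 0] + ρ_XY·𝟙 and Mag(X) = Mag(Y) + 𝟙ᵀ ρ_XY 𝟙. -/
theorem weighting_vector_subset_gluing {n p q : ℕ}
    (y : Fin p → EuclideanSpace ℝ (Fin n)) (z : Fin q → EuclideanSpace ℝ (Fin n))
    (hinj : Function.Injective (Sum.elim y z : Fin p ⊕ Fin q → EuclideanSpace ℝ (Fin n))) :
    let A : Matrix (Fin p) (Fin p) ℝ := Matrix.of fun i j => Real.exp (-dist (y i) (y j))
    let B : Matrix (Fin p) (Fin q) ℝ := Matrix.of fun i j => Real.exp (-dist (y i) (z j))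
    let D : Matrix (Fin q) (Fin q) ℝ := Matrix.of fun i j => Real.exp (-dist (z i) (z j))
    let S : Matrix (Fin q) (Fin q) ℝ := D - Bᵀ * A⁻¹ * B
    let ρ : Matrix (Fin p ⊕ Fin q) (Fin p ⊕ Fin q) ℝ :=
      Matrix.fromBlocks (A⁻¹ * B * S⁻¹ * Bᵀ * A⁻¹) (-(A⁻¹ * B * S⁻¹))
        (-(S⁻¹ * Bᵀ * A⁻¹)) S⁻¹
    let ζX : Matrix (Fin p ⊕ Fin q) (Fin p ⊕ Fin q) ℝ := Matrix.fromBlocks A B Bᵀ D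
    let wX : Fin p ⊕ Fin q → ℝ := ζX⁻¹ *ᵥ fun _ => (1 : ℝ)
    let wY : Fin p → ℝ := A⁻¹ *ᵥ fun _ => (1 : ℝ)
    IsUnit S.det ∧
    wX = Sum.elim wY 0 + ρ *ᵥ (fun _ => (1 : ℝ)) ∧
    dotProduct (fun _ => (1 : ℝ)) (ζX⁻¹ *ᵥ fun _ => (1 : ℝ)) =
      dotProduct (fun _ => (1 : ℝ)) (A⁻¹ *ᵥ fun _ => (1 : ℝ)) +
      dotProduct (fun _ => (1 : ℝ)) (ρ *ᵥ fun _ => (1 : ℝ)) := by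
  intro A B D S ρ ζX wX wY
  have hA : IsUnit A.det := (Matrix.isUnit_iff_isUnit_det _).1
    (posDef_exp_neg_dist (hinj.comp Sum.inl_injective)).isUnit
  have hζ : ζX = Matrix.of fun i j => Real.exp (-dist (Sum.elim y z i) (Sum.elim y z j)) := by
    ext (i | i) (j | j) <;> simp [ζX, A, B, D, dist_comm]
  have hX : IsUnit ζX.det := (Matrix.isUnit_iff_isUnit_det _).1
    (hζ ▸ (posDef_exp_neg_dist hinj).isUnit)
  have hS : IsUnit S.det := by
    have := A.invertibleOfIsUnitDet hA
    rw [det_fromBlocks₁₁, invOf_eq_nonsing_inv] at hX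
    exact isUnit_of_mul_isUnit_right hX
  have hinv : ζX⁻¹ = fromBlocks A⁻¹ 0 0 0 + ρ := inv_fromBlocks_eq_add A B Bᵀ D hA hS
  have hw : wX = Sum.elim wY 0 + ρ *ᵥ (fun _ => (1 : ℝ)) := by
    simp only [wX, hinv, add_mulVec]
    congr 1
    ext (i | i) <;> simp [fromBlocks_mulVec, wY, Function.comp_def]
  refine ⟨hS, hw, ?_⟩
  change dotProduct _ wX = dotProduct _ wY + _
  rw [hw, dotProduct_add]
  simp [dotProduct]
end
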